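/- arXiv:1802.06961 — 2 statements merged into one kernel-verified Lean document; each statement's English description precedes it below -/
import Mathlib

section
/- Let F be a field and let e₁, …, e₈ be the standard basis of F⁸. The unique alternating trilinear map [·,·,·] : F⁸ × F⁸ × F⁸ → F⁸ determined by [e₁,e₂,e₃] = e₇, [e₄,e₅,e₆] = e₈, and [e_i,e_j,e_k] = 0 for every other triple i < j < k, satisfies the Filippov identity, and the resulting 3-Lie algebra A = A_{3,8,7} is nilpotent of class two with A² = Z(A) = span{e₇, e₈} of dimension 2. -/
open scoped Classical

/-- The Filippov (fundamental) identity for an alternating `n`-multilinear bracket: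
`[[x₁,…,xₙ],y₂,…,yₙ] = Σ_{i} [x₁,…,x_{i−1},[xᵢ,y₂,…,yₙ],x_{i+1},…,xₙ]`.
(Since the bracket is alternating, we state it with the distinguished slot `j`
of `y` quantified; for `j = 0` this is the usual form of the identity.) -/
def IsFilippov {F A : Type*} [Field F] [AddCommGroup A] [Module F A] {n : ℕ}
    (B : A [⋀^Fin n]→ₗ[F] A) : Prop :=
  ∀ (x y : Fin n → A) (j : Fin n),
    B (Function.update y j (B x)) =
      ∑ i : Fin n, B (Function.update x i (B (Function.update y j (x i))))

/-- The derived subalgebra `A² = [A,…,A]`, i.e. the span of all bracket values. -/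
def nDerived {F A : Type*} [Field F] [AddCommGroup A] [Module F A] {n : ℕ}
    (B : A [⋀^Fin n]→ₗ[F] A) : Submodule F A :=
  Submodule.span F (Set.range B)

/-- The center `Z(A) = {x : [x,a₂,…,aₙ] = 0 for all aᵢ}` (again with the slot
holding `x` quantified, which is equivalent since the bracket is alternating). -/
def nCenter {F A : Type*} [Field F] [AddCommGroup A] [Module F A] {n : ℕ}
    (B : A [⋀^Fin n]→ₗ[F] A) : Submodule F A where
  carrier := {x | ∀ (v : Fin n → A) (j : Fin n), B (Function.update v j x) = 0}
  add_mem' := by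
    intro a b ha hb v j
    rw [B.map_update_add, ha v j, hb v j, add_zero]
  zero_mem' := by
    intro v j
    exact B.map_update_zero v j
  smul_mem' := by
    intro c a ha v j
    rw [B.map_update_smul, ha v j, smul_zero]

/-- The lower central series `A¹ = A`, `A^{i+1} = [Aⁱ,A,…,A]`. -/
def nLCS {F A : Type*} [Field F] [AddCommGroup A] [Module F A] {n : ℕ}
    (B : A [⋀^Fin n]→ₗ[F] A) : ℕ → Submodule F A
  | 0 => ⊤
  | k + 1 => Submodule.span F {z | ∃ (v : Fin n → A) (j : Fin n), v j ∈ nLCS B k ∧ B v = z}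

/-- An `n`-Lie algebra is nilpotent if its lower central series reaches `0`. -/
def nIsNilpotent {F A : Type*} [Field F] [AddCommGroup A] [Module F A] {n : ℕ}
    (B : A [⋀^Fin n]→ₗ[F] A) : Prop :=
  ∃ k : ℕ, nLCS B k = ⊥

/-- Nilpotent of class two: `A² ≠ 0` and `A² ⊆ Z(A)`. -/
def nClassTwo {F A : Type*} [Field F] [AddCommGroup A] [Module F A] {n : ℕ}
    (B : A [⋀^Fin n]→ₗ[F] A) : Prop :=
  nDerived B ≠ ⊥ ∧ nDerived B ≤ nCenter B

/-- The alternating form on `F⁸` taking three vectors to the minor of their coordinates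
indexed by `c`. -/
def minorForm (F : Type*) [Field F] (c : Fin 3 → Fin 8) : (Fin 8 → F) [⋀^Fin 3]→ₗ[F] F :=
  Matrix.detRowAlternating.compLinearMap (LinearMap.funLeft F F c)

theorem minorForm_apply {F : Type*} [Field F] (c : Fin 3 → Fin 8) (v : Fin 3 → Fin 8 → F) :
    minorForm F c v = Matrix.det (Matrix.of fun i j => v i (c j)) :=
  rfl

theorem minorForm_eq_zero {F : Type*} [Field F] {c : Fin 3 → Fin 8} {v : Fin 3 → Fin 8 → F}
    (i : Fin 3) (h : ∀ j, v i (c j) = 0) : minorForm F c v = 0 :=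
  Matrix.det_eq_zero_of_row_eq_zero i h

theorem minorForm_single_self {F : Type*} [Field F] {c : Fin 3 → Fin 8}
    (hc : Function.Injective c) :
    minorForm F c (fun j => Pi.single (c j) (1 : F)) = 1 := by
  rw [minorForm_apply, ← Matrix.det_one (n := Fin 3)]
  congr 1
  ext i j
  simp [Matrix.one_apply, Pi.single_apply, hc.eq_iff, eq_comm]

/-- The bracket of `A_{3,8,7}`. -/
def bracket387 (F : Type*) [Field F] : (Fin 8 → F) [⋀^Fin 3]→ₗ[F] (Fin 8 → F) :=
  (LinearMap.single F (fun _ : Fin 8 => F) 6).compAlternatingMap (minorForm F ![0, 1, 2]) +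
    (LinearMap.single F (fun _ : Fin 8 => F) 7).compAlternatingMap (minorForm F ![3, 4, 5])

theorem bracket387_apply {F : Type*} [Field F] (v : Fin 3 → Fin 8 → F) :
    bracket387 F v =
      Pi.single 6 (minorForm F ![0, 1, 2] v) + Pi.single 7 (minorForm F ![3, 4, 5] v) :=
  rfl

theorem bracket387_apply_of_lt {F : Type*} [Field F] (v : Fin 3 → Fin 8 → F) {k : Fin 8}
    (hk : k < 6) : bracket387 F v k = 0 := by
  have h6 : k ≠ 6 := hk.ne
  have h7 : k ≠ 7 := (hk.trans (by decide)).ne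
  simp [bracket387_apply, h6, h7]

theorem bracket387_eq_zero {F : Type*} [Field F] {v : Fin 3 → Fin 8 → F} (i : Fin 3)
    (h : ∀ k < 6, v i k = 0) : bracket387 F v = 0 := by
  rw [bracket387_apply, minorForm_eq_zero i, minorForm_eq_zero i]
  · simp
  · intro j
    exact h _ (by fin_cases j <;> decide)
  · intro j
    exact h _ (by fin_cases j <;> decide)

theorem bracket387_single {F : Type*} [Field F] {s : Fin 3 → Fin 8} (hs : StrictMono s) :
    bracket387 F (fun j => Pi.single (s j) (1 : F)) =
      if ∀ j : Fin 3, (s j : ℕ) = (j : ℕ) then Pi.single (6 : Fin 8) (1 : F)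
      else if ∀ j : Fin 3, (s j : ℕ) = (j : ℕ) + 3 then Pi.single (7 : Fin 8) (1 : F)
      else 0 := by
  have h01 : s 0 < s 1 := hs (by decide)
  have h12 : s 1 < s 2 := hs (by decide)
  have vanish (c : Fin 3 → Fin 8) (i : Fin 3) (h : ∀ j, c j ≠ s i) :
      minorForm F c (fun j => Pi.single (s j) (1 : F)) = 0 :=
    minorForm_eq_zero i fun j => Pi.single_eq_of_ne (h j) _
  have hlow (h : ¬ ∀ j : Fin 3, (s j : ℕ) = (j : ℕ)) :
      minorForm F ![0, 1, 2] (fun j => Pi.single (s j) (1 : F)) = 0 := by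
    refine vanish _ 2 fun j => ?_
    have h' : ¬ ((s 0 : ℕ) = 0 ∧ (s 1 : ℕ) = 1 ∧ (s 2 : ℕ) = 2) := by
      simpa [Fin.forall_fin_succ] using h
    fin_cases j <;> simp <;> omega
  have hhigh (h : ¬ ∀ j : Fin 3, (s j : ℕ) = (j : ℕ) + 3) :
      minorForm F ![3, 4, 5] (fun j => Pi.single (s j) (1 : F)) = 0 := by
    by_cases h0 : s 0 < 3
    · refine vanish _ 0 fun j => ?_
      fin_cases j <;> simp <;> omega
    · refine vanish _ 2 fun j => ?_
      have h' : ¬ ((s 0 : ℕ) = 3 ∧ (s 1 : ℕ) = 4 ∧ (s 2 : ℕ) = 5) := by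
        simpa [Fin.forall_fin_succ] using h
      fin_cases j <;> simp <;> omega
  rw [bracket387_apply]
  split_ifs with h₁ h₂
  · have hs' : s = ![0, 1, 2] := by
      ext j
      rw [h₁ j]
      fin_cases j <;> rfl
    rw [hhigh fun h => by simpa [h₁ 0] using h 0, hs', minorForm_single_self (by decide)]
    simp
  · have hs' : s = ![3, 4, 5] := by
      ext j
      rw [h₂ j]
      fin_cases j <;> rfl
    rw [hlow h₁, hs', minorForm_single_self (by decide)]
    simp
  · rw [hlow h₁, hhigh h₂]
    simp

/-- An alternating map on `ι → F` is determined by its values on strictly increasing families of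
standard basis vectors. -/
theorem AlternatingMap.ext_single_strictMono {F M ι : Type*} [Field F] [AddCommGroup M]
    [Module F M] [Fintype ι] [LinearOrder ι] {n : ℕ} {f g : (ι → F) [⋀^Fin n]→ₗ[F] M}
    (h : ∀ s : Fin n → ι, StrictMono s →
      f (fun j => Pi.single (s j) 1) = g (fun j => Pi.single (s j) 1)) : f = g := by
  refine Module.Basis.ext_alternating (Pi.basisFun F ι) fun v hv => ?_
  have hs : StrictMono (v ∘ Tuple.sort v) :=
    (Tuple.monotone_sort v).strictMono_of_injective (hv.comp (Tuple.sort v).injective)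
  have key := h _ hs
  have hf := f.map_perm (fun j => Pi.single (v j) (1 : F)) (Tuple.sort v)
  have hg := g.map_perm (fun j => Pi.single (v j) (1 : F)) (Tuple.sort v)
  have hsmul := hf.symm.trans (key.trans hg)
  simpa using hsmul

theorem isFilippov_bracket387 (F : Type*) [Field F] : IsFilippov (bracket387 F) := by
  intro x y j
  rw [bracket387_eq_zero j fun k hk => by simpa using bracket387_apply_of_lt x hk]
  refine (Finset.sum_eq_zero fun i _ => ?_).symm
  exact bracket387_eq_zero i fun k hk => by simpa using bracket387_apply_of_lt _ hk

theorem bracket387_low (F : Type*) [Field F] :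
    bracket387 F (fun j => Pi.single (![0, 1, 2] j) (1 : F)) = Pi.single 6 1 := by
  rw [bracket387_single (by decide), if_pos (by decide)]

theorem bracket387_high (F : Type*) [Field F] :
    bracket387 F (fun j => Pi.single (![3, 4, 5] j) (1 : F)) = Pi.single 7 1 := by
  rw [bracket387_single (by decide), if_neg (by decide), if_pos (by decide)]

theorem mem_span_single_six_seven {F : Type*} [Field F] {x : Fin 8 → F}
    (h : ∀ k < 6, x k = 0) :
    x ∈ Submodule.span F {Pi.single (6 : Fin 8) (1 : F), Pi.single (7 : Fin 8) (1 : F)} := by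
  refine Submodule.mem_span_pair.mpr ⟨x 6, x 7, ?_⟩
  ext k
  by_cases hk : k < 6
  · have h6 : k ≠ 6 := hk.ne
    have h7 : k ≠ 7 := (hk.trans (by decide)).ne
    simp [h k hk, h6, h7]
  · obtain rfl | rfl : k = 6 ∨ k = 7 := by omega
    · simp
    · simp

theorem nDerived_bracket387 (F : Type*) [Field F] :
    nDerived (bracket387 F) =
      Submodule.span F {Pi.single (6 : Fin 8) (1 : F), Pi.single (7 : Fin 8) (1 : F)} := by
  apply le_antisymm
  · refine Submodule.span_le.mpr ?_
    rintro _ ⟨v, rfl⟩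
    exact mem_span_single_six_seven fun k hk => bracket387_apply_of_lt v hk
  · refine Submodule.span_mono ?_
    rintro _ (rfl | rfl)
    · exact ⟨_, bracket387_low F⟩
    · exact ⟨_, bracket387_high F⟩

/-- Replacing the `i`-th of the basis vectors indexed by `c` by `x` extracts the coordinate
`x (c i)`. -/
theorem minorForm_update_single {F : Type*} [Field F] {c : Fin 3 → Fin 8}
    (hc : Function.Injective c) (i : Fin 3) (x : Fin 8 → F) :
    minorForm F c (Function.update (fun j => Pi.single (c j) (1 : F)) i x) = x (c i) := by
  rw [minorForm_apply, Matrix.det_fin_three]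
  fin_cases i <;> simp [Function.update_apply, hc.eq_iff]

theorem nCenter_bracket387 (F : Type*) [Field F] :
    nCenter (bracket387 F) =
      Submodule.span F {Pi.single (6 : Fin 8) (1 : F), Pi.single (7 : Fin 8) (1 : F)} := by
  apply le_antisymm
  · intro x hx
    have hlow (i : Fin 3) : x (![0, 1, 2] i) = 0 := by
      have h := congrFun (hx (fun j => Pi.single (![0, 1, 2] j) (1 : F)) i) 6
      rw [bracket387_apply, minorForm_update_single (by decide)] at h
      simpa using h
    have hhigh (i : Fin 3) : x (![3, 4, 5] i) = 0 := by
      have h := congrFun (hx (fun j => Pi.single (![3, 4, 5] j) (1 : F)) i) 7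
      rw [bracket387_apply, minorForm_update_single (c := ![3, 4, 5]) (by decide)] at h
      simpa using h
    refine mem_span_single_six_seven fun k hk => ?_
    fin_cases k
    · exact hlow 0
    · exact hlow 1
    · exact hlow 2
    · exact hhigh 0
    · exact hhigh 1
    · exact hhigh 2
    · exact absurd hk (by decide)
    · exact absurd hk (by decide)
  · rw [← nDerived_bracket387]
    refine Submodule.span_le.mpr ?_
    rintro _ ⟨v, rfl⟩ w j
    exact bracket387_eq_zero j fun k hk => by simpa using bracket387_apply_of_lt v hk

theorem finrank_span_single_six_seven (F : Type*) [Field F] :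
    Module.finrank F (Submodule.span F
      ({Pi.single 6 1, Pi.single 7 1} : Set (Fin 8 → F))) = 2 := by
  have hli : LinearIndependent F
      (![Pi.single 6 1, Pi.single 7 1] : Fin 2 → Fin 8 → F) := by
    refine LinearIndependent.pair_iff.mpr fun a b h => ⟨?_, ?_⟩
    · simpa using congrFun h 6
    · simpa using congrFun h 7
  rw [← Matrix.range_cons_cons_empty _ _ ![], finrank_span_eq_card hli, Fintype.card_fin]

/-- The unique alternating trilinear bracket on `F⁸` with `[e₁,e₂,e₃] = e₇`,
`[e₄,e₅,e₆] = e₈` and all other increasing basis brackets zero satisfies the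
Filippov identity, and the resulting 3-Lie algebra `A_{3,8,7}` is nilpotent of
class two with `A² = Z(A) = span{e₇,e₈}` of dimension `2`
(indices are `0`-based; `eᵢ` is `Pi.single i 1`). -/
theorem A_3_8_7_exists_unique (F : Type*) [Field F] :
    ∃ B : (Fin 8 → F) [⋀^Fin 3]→ₗ[F] (Fin 8 → F),
      (∀ s : Fin 3 → Fin 8, StrictMono s →
        B (fun j => Pi.single (s j) (1 : F)) =
          if ∀ j : Fin 3, (s j : ℕ) = (j : ℕ) then Pi.single (6 : Fin 8) (1 : F)
          else if ∀ j : Fin 3, (s j : ℕ) = (j : ℕ) + 3 then Pi.single (7 : Fin 8) (1 : F)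
          else 0) ∧
      (∀ B' : (Fin 8 → F) [⋀^Fin 3]→ₗ[F] (Fin 8 → F),
        (∀ s : Fin 3 → Fin 8, StrictMono s →
          B' (fun j => Pi.single (s j) (1 : F)) =
            if ∀ j : Fin 3, (s j : ℕ) = (j : ℕ) then Pi.single (6 : Fin 8) (1 : F)
            else if ∀ j : Fin 3, (s j : ℕ) = (j : ℕ) + 3 then Pi.single (7 : Fin 8) (1 : F)
            else 0) → B' = B) ∧
      IsFilippov B ∧ nClassTwo B ∧
      nDerived B = nCenter B ∧
      nDerived B =
        Submodule.span F {Pi.single (6 : Fin 8) (1 : F), Pi.single (7 : Fin 8) (1 : F)} ∧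
      Module.finrank F (nDerived B) = 2 := by
  refine ⟨bracket387 F, fun s hs => bracket387_single hs, fun B' hB' => ?_,
    isFilippov_bracket387 F, ⟨fun h => ?_, ?_⟩, ?_, nDerived_bracket387 F, ?_⟩
  · exact AlternatingMap.ext_single_strictMono fun s hs => by
      rw [hB' s hs, bracket387_single hs]
  · have hrank := finrank_span_single_six_seven F
    rw [← nDerived_bracket387, h, finrank_bot] at hrank
    omega
  · rw [nDerived_bracket387, nCenter_bracket387]
  · rw [nDerived_bracket387, nCenter_bracket387]
  · rw [nDerived_bracket387]
    exact finrank_span_single_six_seven F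
end

section
/- Let F be a field, n ≥ 2, m ≥ 1, and let x, x₁, …, x_{nm} be the standard basis of F^{nm+1}. The unique alternating n-multilinear map on F^{nm+1} determined by [x_{n(i−1)+1}, x_{n(i−1)+2}, …, x_{ni}] = x for i = 1, …, m, and zero on every other increasing n-tuple of basis vectors, satisfies the Filippov identity, and the resulting n-Lie algebra H(n,m) satisfies H(n,m)² = Z(H(n,m)) = span{x}, which is 1-dimensional; in particular H(n,m) is nilpotent of class two. -/
open scoped Classical

/-- The position of the `b`-th basis vector of the `i`-th block of the Heisenberg `n`-Lie algebra. -/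
def heisenbergIndex {n m : ℕ} (i : Fin m) (b : Fin n) : Fin (m * n + 1) :=
  ⟨n * i + b + 1, by
    have h : n * (i + 1) ≤ n * m := Nat.mul_le_mul_left n i.2
    have := b.2
    rw [Nat.mul_comm m n]
    rw [Nat.mul_add] at h
    omega⟩

theorem heisenbergIndex_strictMono {n m : ℕ} (i : Fin m) :
    StrictMono (heisenbergIndex i : Fin n → Fin (m * n + 1)) := by
  intro a b h
  have h' : (a : ℕ) < b := h
  simp only [heisenbergIndex, Fin.mk_lt_mk]
  omega

theorem heisenbergIndex_inj {n m : ℕ} {i i' : Fin m} {b b' : Fin n} :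
    heisenbergIndex i b = heisenbergIndex i' b' ↔ i = i' ∧ b = b' := by
  refine ⟨fun h => ?_, fun h => by rw [h.1, h.2]⟩
  have h : n * (i : ℕ) + b = n * i' + b' := by simpa [heisenbergIndex] using h
  have hn : 0 < n := b.pos
  have hd := congrArg (· / n) h
  have hr := congrArg (· % n) h
  simp only [Nat.mul_add_div hn, Nat.div_eq_of_lt b.2, Nat.div_eq_of_lt b'.2,
    Nat.mul_add_mod, Nat.mod_eq_of_lt b.2, Nat.mod_eq_of_lt b'.2] at hd hr
  exact ⟨Fin.ext hd, Fin.ext hr⟩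

theorem heisenbergIndex_ne_zero {n m : ℕ} (i : Fin m) (b : Fin n) :
    heisenbergIndex i b ≠ 0 := by
  simp [heisenbergIndex, Fin.ext_iff]

theorem exists_heisenbergIndex_eq {n m : ℕ} {k : Fin (m * n + 1)} (hk : k ≠ 0) :
    ∃ (i : Fin m) (b : Fin n), heisenbergIndex i b = k := by
  obtain ⟨k, hlt⟩ := k
  obtain _ | k := k
  · exact absurd rfl hk
  have hlt : k < m * n := by omega
  have hn : 0 < n := Nat.pos_of_ne_zero (by rintro rfl; simp at hlt)
  refine ⟨⟨k / n, Nat.div_lt_of_lt_mul (by rwa [Nat.mul_comm])⟩, ⟨k % n, Nat.mod_lt _ hn⟩, ?_⟩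
  simp [heisenbergIndex, Nat.div_add_mod]

/-- The sum over the blocks of the determinants of the coordinates in that block. -/
def heisenbergForm (F : Type*) [Field F] (n m : ℕ) : (Fin (m * n + 1) → F) [⋀^Fin n]→ₗ[F] F :=
  ∑ i : Fin m, (Matrix.detRowAlternating (n := Fin n) (R := F)).compLinearMap
    (LinearMap.funLeft F F (heisenbergIndex i))

theorem heisenbergForm_apply (F : Type*) [Field F] (n m : ℕ) (v : Fin n → Fin (m * n + 1) → F) :
    heisenbergForm F n m v =
      ∑ i : Fin m, (Matrix.of fun a b => v a (heisenbergIndex i b)).det := by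
  let ev : ((Fin (m * n + 1) → F) [⋀^Fin n]→ₗ[F] F) →+ F :=
    { toFun := fun f => f v, map_zero' := rfl, map_add' := fun _ _ => rfl }
  exact map_sum ev _ _

theorem det_single_heisenbergIndex (F : Type*) [Field F] {n m : ℕ}
    {s : Fin n → Fin (m * n + 1)} (hs : StrictMono s) (i : Fin m) :
    (Matrix.of fun a b => (Pi.single (s a) (1 : F) : Fin (m * n + 1) → F)
      (heisenbergIndex i b)).det = if s = heisenbergIndex i then 1 else 0 := by
  split_ifs with h
  · subst h
    convert Matrix.det_one (R := F) (n := Fin n) using 2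
    ext a b
    simp [Pi.single_apply, Matrix.one_apply, heisenbergIndex_inj, eq_comm]
  · obtain ⟨a, ha⟩ : ∃ a, ∀ b, heisenbergIndex i b ≠ s a := by
      by_contra! hc
      choose t ht using hc
      have htm : StrictMono t := fun a b hab =>
        (heisenbergIndex_strictMono i).lt_iff_lt.1 (by rw [ht, ht]; exact hs hab)
      have hsurj : Function.Surjective t := Finite.surjective_of_injective htm.injective
      refine h ((hs.range_inj (heisenbergIndex_strictMono i)).1 ?_)
      rw [← hsurj.range_comp (heisenbergIndex i)]
      exact congrArg Set.range (funext fun a => (ht a).symm)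
    exact Matrix.det_eq_zero_of_row_eq_zero a fun b => by simp [ha b]

theorem heisenbergForm_single (F : Type*) [Field F] {n m : ℕ} (hn : 0 < n)
    {s : Fin n → Fin (m * n + 1)} (hs : StrictMono s) :
    heisenbergForm F n m (fun j => Pi.single (s j) (1 : F)) =
      if ∃ i < m, ∀ j : Fin n, (s j : ℕ) = n * i + (j : ℕ) + 1 then 1 else 0 := by
  rw [heisenbergForm_apply]
  simp only [det_single_heisenbergIndex F hs]
  split_ifs with h
  · obtain ⟨i, hi, h⟩ := h
    have hsi : s = heisenbergIndex ⟨i, hi⟩ := funext fun j => Fin.ext (h j)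
    rw [Finset.sum_eq_single ⟨i, hi⟩ _ (by simp), if_pos hsi]
    intro i' _ hne
    refine if_neg fun h' => hne ?_
    exact (heisenbergIndex_inj.1 (congrFun (h'.symm.trans hsi) ⟨0, hn⟩)).1
  · refine Finset.sum_eq_zero fun i _ => if_neg fun h' => h ⟨i, i.2, fun j => ?_⟩
    rw [h']
    rfl

theorem heisenbergForm_update_zero (F : Type*) [Field F] {n m : ℕ}
    (v : Fin n → Fin (m * n + 1) → F) (j : Fin n) :
    heisenbergForm F n m (Function.update v j (Pi.single 0 1)) = 0 := by
  rw [heisenbergForm_apply]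
  refine Finset.sum_eq_zero fun i _ => Matrix.det_eq_zero_of_row_eq_zero j fun b => ?_
  simp [heisenbergIndex_ne_zero]

theorem heisenbergForm_update (F : Type*) [Field F] {n m : ℕ} (hn : 2 ≤ n) (i : Fin m)
    (j : Fin n) (x : Fin (m * n + 1) → F) :
    heisenbergForm F n m
      (Function.update (fun b => Pi.single (heisenbergIndex i b) (1 : F)) j x) =
      x (heisenbergIndex i j) := by
  rw [heisenbergForm_apply, Finset.sum_eq_single i _ (by simp)]
  · have h : (1 : Matrix (Fin n) (Fin n) F).transpose.cramer (fun b => x (heisenbergIndex i b)) j =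
        x (heisenbergIndex i j) := by simp
    rw [Matrix.cramer_transpose_apply] at h
    rw [← h]
    congr 1
    ext a b
    by_cases ha : a = j
    · subst ha; simp
    · simp [ha, Pi.single_apply, Matrix.one_apply, heisenbergIndex_inj, eq_comm]
  · intro i' _ hne
    have : Nontrivial (Fin n) := Fin.nontrivial_iff_two_le.2 hn
    obtain ⟨a, ha⟩ := exists_ne j
    refine Matrix.det_eq_zero_of_row_eq_zero a fun b => ?_
    simp [ha, heisenbergIndex_inj, hne]

/-- The bracket of the Heisenberg `n`-Lie algebra. -/
def heisenbergBracket (F : Type*) [Field F] (n m : ℕ) :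
    (Fin (m * n + 1) → F) [⋀^Fin n]→ₗ[F] (Fin (m * n + 1) → F) :=
  (LinearMap.toSpanSingleton F (Fin (m * n + 1) → F) (Pi.single 0 1)).compAlternatingMap
    (heisenbergForm F n m)

theorem heisenbergBracket_apply (F : Type*) [Field F] (n m : ℕ)
    (v : Fin n → Fin (m * n + 1) → F) :
    heisenbergBracket F n m v = heisenbergForm F n m v • Pi.single 0 1 := rfl

theorem heisenbergBracket_single (F : Type*) [Field F] {n m : ℕ} (hn : 0 < n)
    {s : Fin n → Fin (m * n + 1)} (hs : StrictMono s) :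
    heisenbergBracket F n m (fun j => Pi.single (s j) (1 : F)) =
      if ∃ i < m, ∀ j : Fin n, (s j : ℕ) = n * i + (j : ℕ) + 1 then Pi.single 0 1 else 0 := by
  rw [heisenbergBracket_apply, heisenbergForm_single F hn hs, ite_smul, one_smul, zero_smul]

theorem nDerived_heisenbergBracket (F : Type*) [Field F] {n m : ℕ} (hn : 0 < n) (hm : 0 < m) :
    nDerived (heisenbergBracket F n m) = Submodule.span F {Pi.single 0 1} := by
  refine le_antisymm (Submodule.span_le.2 ?_) (Submodule.span_mono ?_)
  · rintro _ ⟨v, rfl⟩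
    exact Submodule.smul_mem _ _ (Submodule.mem_span_singleton_self _)
  · rw [Set.singleton_subset_iff]
    refine ⟨_, (heisenbergBracket_single F hn (heisenbergIndex_strictMono ⟨0, hm⟩)).trans ?_⟩
    exact if_pos ⟨0, hm, fun j => rfl⟩

theorem nCenter_heisenbergBracket (F : Type*) [Field F] {n m : ℕ} (hn : 2 ≤ n) :
    nCenter (heisenbergBracket F n m) = Submodule.span F {Pi.single 0 1} := by
  refine le_antisymm (fun x hx => ?_) ?_
  · have h0 : ∀ k, k ≠ 0 → x k = 0 := by
      intro k hk
      obtain ⟨i, b, rfl⟩ := exists_heisenbergIndex_eq hk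
      have h := hx (fun b => Pi.single (heisenbergIndex i b) 1) b
      rw [heisenbergBracket_apply, heisenbergForm_update F hn] at h
      simpa using congrFun h 0
    refine Submodule.mem_span_singleton.2 ⟨x 0, funext fun k => ?_⟩
    by_cases hk : k = 0
    · subst hk; simp
    · simp [hk, h0 k hk]
  · rw [Submodule.span_singleton_le_iff_mem]
    intro v j
    rw [heisenbergBracket_apply, heisenbergForm_update_zero, zero_smul]

/-- A bracket whose derived subalgebra is central satisfies the Filippov identity. -/
theorem isFilippov_of_nDerived_le_nCenter {F A : Type*} [Field F] [AddCommGroup A] [Module F A]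
    {n : ℕ} {B : A [⋀^Fin n]→ₗ[F] A} (h : nDerived B ≤ nCenter B) : IsFilippov B := by
  have hB : ∀ w v j, B (Function.update v j (B w)) = 0 := fun w =>
    h (Submodule.subset_span ⟨w, rfl⟩)
  intro x y j
  simp [hB]

/-- Alternating maps agreeing on increasing families of basis vectors are equal. -/
theorem Module.Basis.ext_alternating_strictMono {R M N ι : Type*} [CommRing R] [AddCommGroup M]
    [Module R M] [AddCommGroup N] [Module R N] [LinearOrder ι] {n : ℕ} (e : Module.Basis ι R M)
    {f g : M [⋀^Fin n]→ₗ[R] N}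
    (h : ∀ s : Fin n → ι, StrictMono s → f (fun j => e (s j)) = g (fun j => e (s j))) :
    f = g := by
  refine Module.Basis.ext_alternating e fun v hv => ?_
  have hs := h (v ∘ Tuple.sort v)
    ((Tuple.monotone_sort v).strictMono_of_injective (hv.comp (Tuple.sort v).injective))
  have hf := f.map_perm (fun j => e (v j)) (Tuple.sort v)
  have hg := g.map_perm (fun j => e (v j)) (Tuple.sort v)
  have : Equiv.Perm.sign (Tuple.sort v) • f (fun j => e (v j)) =
      Equiv.Perm.sign (Tuple.sort v) • g (fun j => e (v j)) := hf.symm.trans (hs.trans hg)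
  exact smul_left_cancel _ this

/-- The unique alternating `n`-multilinear bracket on `F^{nm+1}` with
`[x_{n(i−1)+1},…,x_{ni}] = x` for `i = 1,…,m` and all other increasing basis
brackets zero satisfies the Filippov identity, and the resulting `n`-Lie algebra
`H(n,m)` satisfies `H(n,m)² = Z(H(n,m)) = span{x}` of dimension `1`; in
particular it is nilpotent of class two.  (Here the basis vector `x` is
`Pi.single 0 1` and `x_j` is `Pi.single j 1`.) -/
theorem heisenberg_exists_unique (F : Type*) [Field F] {n m : ℕ}
    (hn : 2 ≤ n) (hm : 1 ≤ m) :
    ∃ B : (Fin (m * n + 1) → F) [⋀^Fin n]→ₗ[F] (Fin (m * n + 1) → F),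
      (∀ s : Fin n → Fin (m * n + 1), StrictMono s →
        B (fun j => Pi.single (s j) (1 : F)) =
          if ∃ i < m, ∀ j : Fin n, (s j : ℕ) = n * i + (j : ℕ) + 1 then
            Pi.single (⟨0, Nat.succ_pos _⟩ : Fin (m * n + 1)) (1 : F)
          else 0) ∧
      (∀ B' : (Fin (m * n + 1) → F) [⋀^Fin n]→ₗ[F] (Fin (m * n + 1) → F),
        (∀ s : Fin n → Fin (m * n + 1), StrictMono s →
          B' (fun j => Pi.single (s j) (1 : F)) =
            if ∃ i < m, ∀ j : Fin n, (s j : ℕ) = n * i + (j : ℕ) + 1 then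
              Pi.single (⟨0, Nat.succ_pos _⟩ : Fin (m * n + 1)) (1 : F)
            else 0) → B' = B) ∧
      IsFilippov B ∧ nClassTwo B ∧
      nDerived B = nCenter B ∧
      nDerived B =
        Submodule.span F {Pi.single (⟨0, Nat.succ_pos _⟩ : Fin (m * n + 1)) (1 : F)} ∧
      Module.finrank F (nDerived B) = 1 := by
  have hd := nDerived_heisenbergBracket F (n := n) (m := m) (by omega) hm
  have hc := nCenter_heisenbergBracket F (m := m) hn
  have hdc := hd.trans hc.symm
  have hne : (Pi.single 0 1 : Fin (m * n + 1) → F) ≠ 0 := by simp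
  refine ⟨heisenbergBracket F n m, fun s hs => heisenbergBracket_single F (by omega) hs,
    fun B' hB' => ?_, isFilippov_of_nDerived_le_nCenter hdc.le, ⟨?_, hdc.le⟩, hdc, hd, ?_⟩
  · refine (Pi.basisFun F (Fin (m * n + 1))).ext_alternating_strictMono fun s hs => ?_
    simp only [Pi.basisFun_apply]
    exact (hB' s hs).trans (heisenbergBracket_single F (by omega) hs).symm
  · rw [hd, Ne, Submodule.span_singleton_eq_bot]
    exact hne
  · rw [hd]
    exact finrank_span_singleton hne
end
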